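/- arXiv:1311.0599 — 3 statements merged into one kernel-verified Lean document; each statement's English description precedes it below -/
import Mathlib

section
/- For positive integers p and q with gcd(p,q) = 1, the number N(SU(p),q) of conjugacy classes of the special unitary group SU(p) consisting of elements x with x^q = 1 satisfies q · N(SU(p),q) = C(p+q-1, q-1); equivalently N(SU(p),q) = (p+q-1)!/(p!·q!). -/
open Matrix

/-- The special unitary group `SU(p)`, as a subgroup of the unitary group
`Matrix.unitaryGroup (Fin p) ℂ` consisting of the elements of determinant `1`. -/
noncomputable def SU (p : ℕ) : Subgroup (Matrix.unitaryGroup (Fin p) ℂ) where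
  carrier := {x | (x : Matrix (Fin p) (Fin p) ℂ).det = 1}
  one_mem' := by simp
  mul_mem' := by
    intro a b ha hb
    simp only [Set.mem_setOf_eq, Matrix.UnitaryGroup.mul_val, Matrix.det_mul] at *
    rw [ha, hb, mul_one]
  inv_mem' := by
    intro a ha
    simp only [Set.mem_setOf_eq, Matrix.UnitaryGroup.inv_val, Matrix.star_eq_conjTranspose,
      Matrix.det_conjTranspose] at *
    rw [ha]; simp

/-- `NSU p m` is the number of conjugacy classes of `SU(p)` all of whose elements `x`
satisfy `x ^ m = 1`. -/
noncomputable def NSU (p m : ℕ) : ℕ :=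
  {c : ConjClasses (SU p) | ∀ x ∈ c.carrier, x ^ m = 1}.ncard

theorem orthogonalFamily_eigenspaces_of_inner_map_map {E : Type*} [NormedAddCommGroup E]
    [InnerProductSpace ℂ E] (T : E →ₗ[ℂ] E) (hT : ∀ v w, inner ℂ (T v) (T w) = inner ℂ v w) :
    OrthogonalFamily ℂ (fun μ : ℂ => Module.End.eigenspace T μ)
      fun μ => (Module.End.eigenspace T μ).subtypeₗᵢ := by
  rintro μ ν hμν ⟨v, hv⟩ ⟨w, hw⟩
  rw [Module.End.mem_eigenspace_iff] at hv hw
  by_cases hv' : v = 0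
  · simp [hv']
  have h1 := hT v v
  have h2 := hT v w
  have hvv : inner ℂ v v ≠ 0 := by simpa using hv'
  rw [hv, inner_smul_left, inner_smul_right, ← mul_assoc] at h1
  rw [hv, hw, inner_smul_left, inner_smul_right, ← mul_assoc] at h2
  have h3 : (starRingEnd ℂ) μ * μ = 1 := mul_right_cancel₀ hvv (by rw [h1, one_mul])
  by_contra h
  have h4 : (starRingEnd ℂ) μ * ν = 1 := mul_right_cancel₀ h (by simpa using h2)
  have h5 : (starRingEnd ℂ) μ ≠ 0 := left_ne_zero_of_mul_eq_one h3
  exact hμν (mul_left_cancel₀ h5 (h3.trans h4.symm))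

theorem exists_orthonormalBasis_eigenvectors {E : Type*} [NormedAddCommGroup E]
    [InnerProductSpace ℂ E] [FiniteDimensional ℂ E] {n : ℕ} (hn : Module.finrank ℂ E = n)
    (T : E →ₗ[ℂ] E) (hT : ∀ v w, inner ℂ (T v) (T w) = inner ℂ v w)
    (hs : Module.End.IsSemisimple T) :
    ∃ (b : OrthonormalBasis (Fin n) ℂ E) (d : Fin n → ℂ), ∀ i, T (b i) = d i • b i := by
  have hO : OrthogonalFamily ℂ (fun μ : Module.End.Eigenvalues T => Module.End.eigenspace T μ)
      fun μ => (Module.End.eigenspace T μ).subtypeₗᵢ :=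
    (orthogonalFamily_eigenspaces_of_inner_map_map T hT).comp Subtype.coe_injective
  have hI : DirectSum.IsInternal
      fun μ : Module.End.Eigenvalues T => Module.End.eigenspace T μ := by
    refine hO.isInternal_iff.mpr ?_
    change (⨆ μ : { μ // Module.End.eigenspace T μ ≠ ⊥ }, Module.End.eigenspace T μ)ᗮ = ⊥
    rw [iSup_ne_bot_subtype, hs.iSup_eigenspace_eq_top, Submodule.top_orthogonal_eq_bot]
  exact ⟨hI.subordinateOrthonormalBasis hn hO,
    fun i => (hI.subordinateOrthonormalBasisIndex hn i hO).val, fun i =>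
    Module.End.mem_eigenspace_iff.mp (hI.subordinateOrthonormalBasis_subordinate hn i hO)⟩

theorem exists_unitary_mul_eq_mul_diagonal {p q : ℕ} (hq : q ≠ 0)
    (x : unitaryGroup (Fin p) ℂ) (hx : x ^ q = 1) :
    ∃ (P : unitaryGroup (Fin p) ℂ) (d : Fin p → ℂ),
      (x : Matrix (Fin p) (Fin p) ℂ) * P = P * diagonal d := by
  obtain ⟨A, hA⟩ : ∃ A : Matrix (Fin p) (Fin p) ℂ, A = x.1 := ⟨_, rfl⟩
  have hAq : A ^ q = 1 := by simpa [hA] using congrArg Subtype.val hx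
  have hAA : Aᴴ * A = 1 := (Matrix.mem_unitaryGroup_iff').mp (hA ▸ x.2)
  set T := Matrix.toLpLin 2 2 A with hTdef
  have hT : ∀ v w, inner ℂ (T v) (T w) = inner ℂ v w := by
    intro v w
    simp only [EuclideanSpace.inner_eq_star_dotProduct, hTdef, toLpLin_apply, star_mulVec]
    rw [dotProduct_comm, ← dotProduct_mulVec, mulVec_mulVec, hAA, one_mulVec, dotProduct_comm]
  have hs : Module.End.IsSemisimple T := by
    refine Module.End.isSemisimple_of_squarefree_aeval_eq_zero
      (p := (Polynomial.X ^ q - 1 : Polynomial ℂ)) ?_ ?_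
    · exact (Polynomial.X_pow_sub_one_separable_iff.mpr (by exact_mod_cast hq)).squarefree
    · have : T ^ q = 1 := by
        rw [hTdef, ← toLpLin_pow, hAq, toLpLin_one]
        rfl
      simp [this]
  obtain ⟨b, d, h⟩ := exists_orthonormalBasis_eigenvectors (n := p) (by simp) T hT hs
  refine ⟨⟨(EuclideanSpace.basisFun (Fin p) ℂ).toBasis.toMatrix b.toBasis,
    (EuclideanSpace.basisFun (Fin p) ℂ).toMatrix_orthonormalBasis_mem_unitary b⟩, d, ?_⟩
  ext i j
  have := congrFun (congrArg WithLp.ofLp (h j)) i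
  simp only [hTdef, toLpLin_apply] at this
  rw [mul_diagonal, ← hA]
  simpa [Matrix.mul_apply, mulVec, dotProduct, Module.Basis.toMatrix_apply, mul_comm] using this

theorem charpoly_roots_diagonal {p : ℕ} (d : Fin p → ℂ) :
    (diagonal d).charpoly.roots = Finset.univ.val.map d := by
  rw [charpoly_diagonal]
  convert Polynomial.roots_multiset_prod_X_sub_C (Finset.univ.val.map d)
  rw [Multiset.map_map]
  rfl

theorem charpoly_roots_eq_of_mul_eq_mul_diagonal {p : ℕ} {x P : unitaryGroup (Fin p) ℂ}
    {d : Fin p → ℂ} (h : (x : Matrix (Fin p) (Fin p) ℂ) * P = P * diagonal d) :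
    (x : Matrix (Fin p) (Fin p) ℂ).charpoly.roots = Finset.univ.val.map d := by
  have hP : (P : Matrix (Fin p) (Fin p) ℂ) * star (P : Matrix (Fin p) (Fin p) ℂ) = 1 :=
    Matrix.mem_unitaryGroup_iff.mp P.2
  have hx : (x : Matrix (Fin p) (Fin p) ℂ) = (Unitary.toUnits P).val * diagonal d *
      (Unitary.toUnits P)⁻¹.val := by
    change _ = (P : Matrix (Fin p) (Fin p) ℂ) * _ * star (P : Matrix (Fin p) (Fin p) ℂ)
    rw [← h, mul_assoc, hP, mul_one]
  rw [hx, coe_units_inv, charpoly_units_conj, charpoly_roots_diagonal]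

theorem exists_perm_comp_eq_of_map_univ_eq {ι α : Type*} [Fintype ι] {d e : ι → α}
    (h : Finset.univ.val.map d = Finset.univ.val.map e) : ∃ σ : Equiv.Perm ι, d ∘ σ = e := by
  classical
  have hc (a : α) : Nonempty ({i // e i = a} ≃ {i // d i = a}) := by
    refine Fintype.card_eq.mp ?_
    have := congrArg (Multiset.count a) h
    rw [Multiset.count_map, Multiset.count_map] at this
    rw [Fintype.card_subtype, Fintype.card_subtype]
    simp only [eq_comm (a := a)] at this
    exact this.symm
  refine ⟨(Equiv.sigmaFiberEquiv e).symm.trans ((Equiv.sigmaCongrRight fun a => (hc a).some).trans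
    (Equiv.sigmaFiberEquiv d)), funext fun i => ?_⟩
  exact ((hc (e i)).some ⟨i, rfl⟩).2

theorem card_mul_card_sym_prod_eq_one {G : Type*} [CommGroup G] [Finite G] {p : ℕ}
    (h : (Nat.card G).Coprime p) :
    Nat.card G * Nat.card {s : Sym G p // (s : Multiset G).prod = 1} = Nat.card (Sym G p) := by
  have hprod (g : G) (s : Sym G p) :
      ((s.map (g * ·) : Sym G p) : Multiset G).prod = g ^ p * (s : Multiset G).prod := by
    rw [Sym.coe_map, Multiset.prod_map_mul, Multiset.map_id']
    simp
  let r (s : Sym G p) : G := (powCoprime h).symm (s : Multiset G).prod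
  have hr (s : Sym G p) : r s ^ p = (s : Multiset G).prod := (powCoprime h).apply_symm_apply _
  rw [← Nat.card_prod]
  refine Nat.card_congr
    { toFun := fun x => x.2.1.map (x.1 * ·)
      invFun := fun s => ⟨r s, s.map ((r s)⁻¹ * ·), by rw [hprod, inv_pow, hr, inv_mul_cancel]⟩
      left_inv := ?_
      right_inv := ?_ }
  · rintro ⟨g, s, hs⟩
    have hg : r (s.map (g * ·)) = g := by
      apply (powCoprime h).injective
      change _ ^ p = g ^ p
      rw [hr, hprod, hs, mul_one]
    simp only [hg, Sym.map_map]
    simp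
  · intro s
    simp [Sym.map_map]

theorem ncard_multiset_roots_of_unity_prod_eq_one {p q : ℕ} (hq : 0 < q) :
    {m : Multiset ℂ | m.card = p ∧ (∀ z ∈ m, z ^ q = 1) ∧ m.prod = 1}.ncard =
      Nat.card {s : Sym (rootsOfUnity q ℂ) p // (s : Multiset (rootsOfUnity q ℂ)).prod = 1} := by
  have : NeZero q := ⟨hq.ne'⟩
  let φ : rootsOfUnity q ℂ →* ℂ := (Units.coeHom ℂ).comp (rootsOfUnity q ℂ).subtype
  have hφ : Function.Injective φ := Units.val_injective.comp Subtype.val_injective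
  rw [← Nat.card_coe_set_eq]
  symm
  refine Nat.card_congr (Equiv.ofBijective
    (fun s => ⟨(s.1 : Multiset _).map φ, ?_, ?_, ?_⟩) ⟨?_, ?_⟩)
  · simp
  · intro z hz
    obtain ⟨u, -, rfl⟩ := Multiset.mem_map.mp hz
    simpa [φ] using congrArg Units.val u.2
  · rw [Multiset.prod_hom, s.2, map_one]
  · intro s t h
    exact Subtype.ext (Sym.coe_injective
      (Multiset.map_injective hφ (congrArg Subtype.val h)))
  · rintro ⟨m, hm, hm1, hm2⟩
    obtain ⟨t, rfl⟩ : ∃ t : Multiset (rootsOfUnity q ℂ), t.map φ = m := by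
      have : CanLift ℂ (rootsOfUnity q ℂ) φ (fun z => z ^ q = 1) :=
        ⟨fun z hz => ⟨rootsOfUnity.mkOfPowEq z hz, rfl⟩⟩
      exact CanLift.prf m hm1
    rw [Multiset.card_map] at hm
    refine ⟨⟨⟨t, hm⟩, hφ ?_⟩, rfl⟩
    rw [map_one, ← hm2, ← Multiset.prod_hom]
    rfl

theorem exists_SU_mul_eq_mul_diagonal {p q : ℕ} (hp : 0 < p) (hq : 0 < q)
    (x : unitaryGroup (Fin p) ℂ) (hx : x ^ q = 1) {e : Fin p → ℂ}
    (he : (x : Matrix (Fin p) (Fin p) ℂ).charpoly.roots = Finset.univ.val.map e) :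
    ∃ P : SU p, (x : Matrix (Fin p) (Fin p) ℂ) * P.1.1 = P.1.1 * diagonal e := by
  obtain ⟨P, d, h⟩ := exists_unitary_mul_eq_mul_diagonal hq.ne' x hx
  obtain ⟨σ, rfl⟩ := exists_perm_comp_eq_of_map_univ_eq
    ((charpoly_roots_eq_of_mul_eq_mul_diagonal h).symm.trans he)
  have hPP : P.1 * star P.1 = 1 := Matrix.mem_unitaryGroup_iff.mp P.2
  set R : Matrix (Fin p) (Fin p) ℂ := P.1.submatrix id σ with hR
  have hRR : R * star R = 1 := by
    rw [hR, star_eq_conjTranspose, conjTranspose_submatrix, submatrix_mul_equiv,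
      ← star_eq_conjTranspose, hPP]
    simp
  have hdet : ‖R.det‖ = 1 :=
    CStarRing.norm_of_mem_unitary (Matrix.det_of_mem_unitary (Matrix.mem_unitaryGroup_iff.mpr hRR))
  obtain ⟨c, hc⟩ := IsAlgClosed.exists_pow_nat_eq R.det⁻¹ hp
  have hcn : ‖c‖ = 1 := by
    have : ‖c‖ ^ p = 1 := by rw [← norm_pow, hc, norm_inv, hdet, inv_one]
    exact (pow_eq_one_iff_of_nonneg (norm_nonneg c) hp.ne').mp this
  have hcc : c * star c = 1 := by
    have := Complex.mul_conj' c
    rw [hcn] at this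
    simpa using this
  refine ⟨⟨⟨c • R, Matrix.mem_unitaryGroup_iff.mpr ?_⟩, ?_⟩, ?_⟩
  · rw [star_smul, smul_mul_smul_comm, hRR, hcc, one_smul]
  · change (c • R).det = 1
    rw [det_smul, Fintype.card_fin, hc, inv_mul_cancel₀]
    exact norm_ne_zero_iff.mp (by rw [hdet]; exact one_ne_zero)
  · change x.1 * (c • R) = (c • R) * _
    rw [mul_smul_comm, smul_mul_assoc]
    congr 1
    ext i j
    have := congrFun (congrFun h i) (σ j)
    rw [mul_diagonal] at this ⊢
    exact this

theorem exists_SU_eq_diagonal {p q : ℕ} (hq : 0 < q) {e : Fin p → ℂ} (he : ∀ i, e i ^ q = 1)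
    (hprod : ∏ i, e i = 1) : ∃ D : SU p, D.1.1 = diagonal e ∧ D ^ q = 1 := by
  refine ⟨⟨⟨diagonal e, Matrix.mem_unitaryGroup_iff.mpr ?_⟩, ?_⟩, rfl, ?_⟩
  · rw [star_eq_conjTranspose, diagonal_conjTranspose, diagonal_mul_diagonal, ← diagonal_one]
    congr 1
    ext i
    have := Complex.mul_conj' (e i)
    rw [Complex.norm_eq_one_of_pow_eq_one (he i) hq.ne'] at this
    simpa using this
  · change (diagonal e).det = 1
    rw [det_diagonal, hprod]
  · refine Subtype.ext (Subtype.ext ?_)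
    change diagonal e ^ q = 1
    rw [diagonal_pow, ← diagonal_one]
    congr 1
    ext i
    exact he i

theorem charpoly_eq_of_isConj {p : ℕ} {x y : SU p} (h : IsConj x y) :
    x.1.1.charpoly = y.1.1.charpoly := by
  obtain ⟨c, hc⟩ := isConj_iff.mp h
  rw [← hc]
  have := charpoly_units_conj (Unitary.toUnits c.1) x.1.1
  rw [← coe_units_inv] at this
  exact this.symm

theorem isConj_of_SU_mul_eq_mul {p : ℕ} {x P D : SU p} (h : x.1.1 * P.1.1 = P.1.1 * D.1.1) :
    IsConj D x := by
  have : x * P = P * D := Subtype.ext (Subtype.ext h)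
  exact isConj_iff.mpr ⟨P, by rw [← this, mul_inv_cancel_right]⟩

/-- The multiset of eigenvalues of a conjugacy class of `SU p`. -/
noncomputable def eigenvaluesOfConjClass (p : ℕ) : ConjClasses (SU p) → Multiset ℂ :=
  Quotient.lift (fun x : SU p => x.1.1.charpoly.roots)
    fun _ _ h => congrArg Polynomial.roots (charpoly_eq_of_isConj h)

theorem forall_mem_carrier_mk_pow_eq_one_iff {G : Type*} [Group G] {m : ℕ} {x : G} :
    (∀ y ∈ (ConjClasses.mk x).carrier, y ^ m = 1) ↔ x ^ m = 1 := by
  refine ⟨fun h => h x ConjClasses.mem_carrier_mk, fun h y hy => ?_⟩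
  rw [ConjClasses.mem_carrier_iff_mk_eq, ConjClasses.mk_eq_mk_iff_isConj] at hy
  obtain ⟨c, rfl⟩ := isConj_iff.mp hy.symm
  rw [conj_pow, h, mul_one, mul_inv_cancel]

theorem exists_map_univ_eq {α : Type*} {p : ℕ} {m : Multiset α} (hm : m.card = p) :
    ∃ e : Fin p → α, Finset.univ.val.map e = m := by
  subst hm
  induction m using Quotient.inductionOn with
  | h l => exact ⟨l.get, (Fin.univ_val_map _).trans (congrArg _ (List.ofFn_get l))⟩

theorem exists_isConj_diagonal {p q : ℕ} (hp : 0 < p) (hq : 0 < q) (x : SU p) (hx : x ^ q = 1)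
    {e : Fin p → ℂ} (he : x.1.1.charpoly.roots = Finset.univ.val.map e) :
    (∀ i, e i ^ q = 1) ∧ ∏ i, e i = 1 ∧ ∀ D : SU p, D.1.1 = diagonal e → IsConj D x := by
  obtain ⟨P, hP⟩ := exists_SU_mul_eq_mul_diagonal hp hq x.1 (congrArg Subtype.val hx) he
  have hPP : star P.1.1 * P.1.1 = 1 := Matrix.mem_unitaryGroup_iff'.mp P.1.2
  obtain ⟨D, hD⟩ : ∃ D : SU p, D = P⁻¹ * x * P := ⟨_, rfl⟩
  have hDe : D.1.1 = diagonal e := by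
    rw [hD]
    change star P.1.1 * x.1.1 * P.1.1 = _
    rw [mul_assoc, hP, ← mul_assoc, hPP, one_mul]
  have hDq : D ^ q = 1 := by
    have := conj_pow (i := q) (a := P⁻¹) (b := x)
    rw [inv_inv, ← hD, hx, mul_one, inv_mul_cancel] at this
    exact this
  have hdet : D.1.1.det = 1 := D.2
  refine ⟨fun i => ?_, by rwa [hDe, det_diagonal] at hdet, fun D' hD' =>
    isConj_of_SU_mul_eq_mul (P := P) (by rw [hP, hD'])⟩
  have h1 : D.1.1 ^ q = 1 := congrArg (fun z : SU p => z.1.1) hDq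
  rw [hDe, diagonal_pow, ← diagonal_one] at h1
  exact congrFun (diagonal_injective h1) i

theorem NSU_eq_ncard_multiset {p q : ℕ} (hp : 0 < p) (hq : 0 < q) :
    NSU p q = {m : Multiset ℂ | m.card = p ∧ (∀ z ∈ m, z ^ q = 1) ∧ m.prod = 1}.ncard := by
  have hroots (x : SU p) : ∃ e : Fin p → ℂ, Finset.univ.val.map e = x.1.1.charpoly.roots := by
    apply exists_map_univ_eq
    rw [← (IsAlgClosed.splits _).natDegree_eq_card_roots, charpoly_natDegree_eq_dim,
      Fintype.card_fin]
  refine Set.ncard_congr (fun c _ => eigenvaluesOfConjClass p c) ?_ ?_ ?_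
  · rintro ⟨x⟩ hx
    replace hx : x ^ q = 1 := forall_mem_carrier_mk_pow_eq_one_iff.mp hx
    obtain ⟨e, he⟩ := hroots x
    obtain ⟨h1, h2, -⟩ := exists_isConj_diagonal hp hq x hx he.symm
    change x.1.1.charpoly.roots ∈ _
    rw [← he]
    refine ⟨by simp, fun z hz => ?_, h2⟩
    obtain ⟨i, -, rfl⟩ := Multiset.mem_map.mp hz
    exact h1 i
  · rintro ⟨x⟩ ⟨y⟩ hx hy (h : x.1.1.charpoly.roots = y.1.1.charpoly.roots)
    replace hx : x ^ q = 1 := forall_mem_carrier_mk_pow_eq_one_iff.mp hx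
    replace hy : y ^ q = 1 := forall_mem_carrier_mk_pow_eq_one_iff.mp hy
    obtain ⟨e, he⟩ := hroots x
    obtain ⟨h1, h2, h3⟩ := exists_isConj_diagonal hp hq x hx he.symm
    obtain ⟨-, -, h4⟩ := exists_isConj_diagonal hp hq y hy (he.trans h).symm
    obtain ⟨D, hD, -⟩ := exists_SU_eq_diagonal hq h1 h2
    exact ConjClasses.mk_eq_mk_iff_isConj.mpr ((h3 D hD).symm.trans (h4 D hD))
  · rintro m ⟨hm, hm1, hm2⟩
    obtain ⟨e, rfl⟩ := exists_map_univ_eq hm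
    obtain ⟨D, hD, hDq⟩ := exists_SU_eq_diagonal hq (e := e)
      (fun i => hm1 _ (Multiset.mem_map_of_mem e (Finset.mem_univ i))) hm2
    refine ⟨ConjClasses.mk D, forall_mem_carrier_mk_pow_eq_one_iff.mpr hDq, ?_⟩
    change D.1.1.charpoly.roots = _
    rw [hD, charpoly_roots_diagonal]

theorem card_mul_NSU {p q : ℕ} (hp : 0 < p) (hq : 0 < q) (hpq : Nat.gcd p q = 1) :
    q * NSU p q = (p + q - 1).choose (q - 1) := by
  have : NeZero q := ⟨hq.ne'⟩
  have hcard : Nat.card (rootsOfUnity q ℂ) = q := Complex.card_rootsOfUnity q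
  have h := card_mul_card_sym_prod_eq_one (G := rootsOfUnity q ℂ) (p := p)
    (by rw [hcard]; exact Nat.Coprime.symm hpq)
  have := Fintype.ofFinite (rootsOfUnity q ℂ)
  classical
  rw [← ncard_multiset_roots_of_unity_prod_eq_one hq, ← NSU_eq_ncard_multiset hp hq, hcard,
    Nat.card_eq_fintype_card, Sym.card_sym_eq_choose, ← Nat.card_eq_fintype_card, hcard,
    add_comm q p] at h
  rw [h]
  exact Nat.choose_symm_of_eq_add (by omega)

/-- For coprime positive integers `p` and `q`, `q · N(SU(p), q) = C(p + q - 1, q - 1)`;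
equivalently `N(SU(p), q) = (p + q - 1)! / (p! · q!)`. -/
theorem stmt_1 (p q : ℕ) (hp : 0 < p) (hq : 0 < q) (hpq : Nat.gcd p q = 1) :
    q * NSU p q = Nat.choose (p + q - 1) (q - 1) ∧
      NSU p q = Nat.factorial (p + q - 1) / (Nat.factorial p * Nat.factorial q) := by
  have h := card_mul_NSU hp hq hpq
  refine ⟨h, (Nat.div_eq_of_eq_mul_left (by positivity) ?_).symm⟩
  have h2 := Nat.choose_mul_factorial_mul_factorial (n := p + q - 1) (k := q - 1) (by omega)
  rw [← h, show p + q - 1 - (q - 1) = p by omega] at h2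
  rw [← h2, ← Nat.mul_factorial_pred hq.ne']
  ring
end

section
/- For any positive integers n, m, and s, the number of conjugacy classes of the unitary group U(n) consisting of elements x with x^m = 1 and with exactly s distinct eigenvalues equals C(n-1, s-1) · C(m, s). -/
open Matrix

theorem exists_perm_of_map_univ_eq {ι α : Type*} [Fintype ι] {d e : ι → α}
    (h : Finset.univ.val.map d = Finset.univ.val.map e) :
    ∃ σ : Equiv.Perm ι, d = e ∘ σ := by
  classical
  have key (z : α) : Nonempty ({i // d i = z} ≃ {i // e i = z}) := by
    refine ⟨Fintype.equivOfCardEq ?_⟩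
    have := congrArg (Multiset.count z) h
    simp only [Multiset.count_map, ← Finset.filter_val, Finset.card_val, eq_comm (a := z)] at this
    simpa [Fintype.card_subtype] using this
  exact ⟨Equiv.ofFiberEquiv fun z => (key z).some, funext fun i => (Equiv.ofFiberEquiv_map _ i).symm⟩

theorem unitaryGroup_diagonal_perm {ι : Type*} [Fintype ι] [DecidableEq ι] (e : ι → ℂ)
    (σ : Equiv.Perm ι) : ∃ P : unitaryGroup ι ℂ,
      (P : Matrix ι ι ℂ) * diagonal e = diagonal (e ∘ σ) * P := by
  refine ⟨⟨(1 : Matrix ι ι ℂ).submatrix σ id, ?_⟩, ?_⟩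
  · rw [mem_unitaryGroup_iff, star_eq_conjTranspose, conjTranspose_submatrix, conjTranspose_one]
    ext i j
    simp [mul_apply, one_apply]
  · ext i j
    simp [mul_diagonal, diagonal_mul, one_apply]
    split_ifs with h
    · rw [h]
    · rfl

open Module End in
theorem exists_diagonal_of_pow_eq_one {n m : ℕ} (hm : 0 < m) (x : unitaryGroup (Fin n) ℂ)
    (hx : x ^ m = 1) : ∃ (U : unitaryGroup (Fin n) ℂ) (d : Fin n → ℂ),
      (x : Matrix (Fin n) (Fin n) ℂ) * U = U * diagonal d := by
  classical
  set A : Matrix (Fin n) (Fin n) ℂ := x.1 with hA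
  set T : End ℂ (EuclideanSpace ℂ (Fin n)) := toLpLin 2 2 A with hT
  have hAm : A ^ m = 1 := by simpa using congrArg Subtype.val hx
  have hTm : T ^ m = 1 := by
    rw [hT, ← toLpLin_pow, hAm, toLpLin_one]
    rfl
  have hss : T.IsSemisimple := by
    refine isSemisimple_of_squarefree_aeval_eq_zero
      (p := Polynomial.X ^ m - Polynomial.C (1 : ℂ))
      (Polynomial.separable_X_pow_sub_C 1 (by exact_mod_cast hm.ne') one_ne_zero).squarefree ?_
    simp [hTm]
  have hinner (v w : EuclideanSpace ℂ (Fin n)) : inner ℂ (T v) (T w) = inner ℂ v w := by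
    have hadj : LinearMap.adjoint T * T = 1 := by
      rw [hT, ← toEuclideanLin_conjTranspose_eq_adjoint, Module.End.mul_eq_comp,
        ← toLpLin_mul_same, ← star_eq_conjTranspose, mem_unitaryGroup_iff'.mp x.2, toLpLin_one]
      rfl
    rw [← LinearMap.adjoint_inner_right, ← Module.End.mul_apply, hadj, Module.End.one_apply]
  have hmod {z : ℂ} {v : EuclideanSpace ℂ (Fin n)} (hv : v ≠ 0) (h : T v = z • v) :
      star z * z = 1 := by
    have := hinner v v
    rw [h, inner_smul_left, inner_smul_right, ← mul_assoc] at this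
    exact mul_right_cancel₀ (inner_self_ne_zero.mpr hv) (this.trans (one_mul _).symm)
  have hfam : OrthogonalFamily ℂ (fun μ : Eigenvalues T => eigenspace T μ)
      fun μ => (eigenspace T μ).subtypeₗᵢ := by
    rintro ⟨μ, hμ⟩ ⟨ν, hν⟩ hne ⟨v, hv⟩ ⟨w, hw⟩
    rw [mem_eigenspace_iff] at hv hw
    by_cases hv0 : v = 0
    · subst hv0
      exact inner_zero_left _
    have h := hinner v w
    rw [hv, hw, inner_smul_left, inner_smul_right, ← mul_assoc] at h
    by_contra hvw
    have h1 : star μ * ν = 1 := mul_right_cancel₀ hvw (h.trans (one_mul _).symm)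
    have h2 := hmod hv0 hv
    have h0 : star μ ≠ 0 := left_ne_zero_of_mul_eq_one h1
    exact hne (Subtype.ext (mul_left_cancel₀ h0 (h2.trans h1.symm)))
  have hint : DirectSum.IsInternal fun μ : Eigenvalues T => eigenspace T μ := by
    rw [hfam.isInternal_iff]
    change (⨆ μ : { μ // eigenspace T μ ≠ ⊥ }, eigenspace T μ)ᗮ = ⊥
    rw [iSup_ne_bot_subtype, hss.iSup_eigenspace_eq_top, Submodule.top_orthogonal_eq_bot]
  let b := hint.subordinateOrthonormalBasis (finrank_euclideanSpace_fin (𝕜 := ℂ) (n := n)) hfam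
  let d : Fin n → ℂ := fun i => (hint.subordinateOrthonormalBasisIndex
    (finrank_euclideanSpace_fin (𝕜 := ℂ) (n := n)) i hfam).1
  have hb (i : Fin n) : T (b i) = d i • b i := mem_eigenspace_iff.mp
    (hint.subordinateOrthonormalBasis_subordinate finrank_euclideanSpace_fin i hfam)
  refine ⟨⟨(EuclideanSpace.basisFun (Fin n) ℂ).toBasis.toMatrix b.toBasis,
    (EuclideanSpace.basisFun (Fin n) ℂ).toMatrix_orthonormalBasis_mem_unitary b⟩, d, ?_⟩
  ext i j
  have := congrArg (fun v => v i) (hb j)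
  rw [mul_diagonal, Matrix.mul_apply]
  simpa [hT, toLpLin_apply, mulVec, dotProduct, Basis.toMatrix_apply, mul_comm] using this

theorem charpoly_roots_of_mul_eq {n : ℕ} {A : Matrix (Fin n) (Fin n) ℂ}
    {U : unitaryGroup (Fin n) ℂ} {d : Fin n → ℂ} (h : A * U = U * diagonal d) :
    A.charpoly.roots = Finset.univ.val.map d := by
  have hA : A = U * diagonal d * star (U : Matrix (Fin n) (Fin n) ℂ) := by
    rw [← h, mul_assoc, mem_unitaryGroup_iff.mp U.2, mul_one]
  rw [hA, charpoly_mul_comm, ← mul_assoc, mem_unitaryGroup_iff'.mp U.2, one_mul, charpoly_diagonal,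
    Polynomial.roots_prod _ _ (by simp [Finset.prod_ne_zero_iff, Polynomial.X_sub_C_ne_zero])]
  simp

theorem isConj_of_charpoly_roots_eq {n m : ℕ} (hm : 0 < m) {x y : unitaryGroup (Fin n) ℂ}
    (hx : x ^ m = 1) (hy : y ^ m = 1)
    (h : (x : Matrix (Fin n) (Fin n) ℂ).charpoly.roots =
      (y : Matrix (Fin n) (Fin n) ℂ).charpoly.roots) : IsConj x y := by
  obtain ⟨U, d, hU⟩ := exists_diagonal_of_pow_eq_one hm x hx
  obtain ⟨V, e, hV⟩ := exists_diagonal_of_pow_eq_one hm y hy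
  rw [charpoly_roots_of_mul_eq hU, charpoly_roots_of_mul_eq hV] at h
  obtain ⟨σ, rfl⟩ := exists_perm_of_map_univ_eq h
  obtain ⟨P, hP⟩ := unitaryGroup_diagonal_perm e σ
  refine isConj_iff.mpr ⟨V * P⁻¹ * U⁻¹, ?_⟩
  have hmul : P * (V⁻¹ * y * V) = U⁻¹ * x * U * P := by
    have hx' : ((U⁻¹ * x * U : unitaryGroup (Fin n) ℂ) : Matrix (Fin n) (Fin n) ℂ) =
        diagonal (e ∘ σ) := by
      change star U.1 * x.1 * U.1 = _
      rw [mul_assoc, hU, ← mul_assoc, mem_unitaryGroup_iff'.mp U.2, one_mul]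
    have hy' : ((V⁻¹ * y * V : unitaryGroup (Fin n) ℂ) : Matrix (Fin n) (Fin n) ℂ) =
        diagonal e := by
      change star V.1 * y.1 * V.1 = _
      rw [mul_assoc, hV, ← mul_assoc, mem_unitaryGroup_iff'.mp V.2, one_mul]
    apply Subtype.ext
    change P.1 * (V⁻¹ * y * V).1 = (U⁻¹ * x * U).1 * P.1
    rw [hx', hy', hP]
  calc V * P⁻¹ * U⁻¹ * x * (V * P⁻¹ * U⁻¹)⁻¹
      = V * P⁻¹ * (U⁻¹ * x * U * P) * V⁻¹ := by group
    _ = y := by rw [← hmul]; group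

theorem Finset.ncard_multiset_toFinset_eq {α : Type*} [DecidableEq α] {A : Finset α}
    (hA : A.Nonempty) {n : ℕ} (hn : 0 < n) :
    {M : Multiset α | M.card = n ∧ M.toFinset = A}.ncard = (n - 1).choose (A.card - 1) := by
  have hpos := hA.card_pos
  rcases lt_or_ge n A.card with h | h
  · rw [Nat.choose_eq_zero_of_lt (by omega)]
    refine (congrArg Set.ncard (Set.eq_empty_of_forall_notMem ?_)).trans (Set.ncard_empty _)
    rintro M ⟨rfl, rfl⟩
    exact h.not_ge M.toFinset_card_le
  · have hsym := Sym.natCard_sym_eq_choose A (n - A.card)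
    rw [Nat.card_eq_fintype_card (α := A), Fintype.card_coe, show A.card + (n - A.card) - 1 = n - 1 by omega,
      ← Nat.choose_symm (by omega), show n - 1 - (n - A.card) = A.card - 1 by omega] at hsym
    rw [← hsym, ← Set.ncard_univ]
    symm
    refine Set.ncard_congr (fun t _ => A.val + t.1.map Subtype.val) ?_ ?_ ?_
    · rintro ⟨t, ht⟩ -
      refine ⟨by simp [ht]; omega, ?_⟩
      ext a
      simp only [Multiset.toFinset_add, Finset.val_toFinset, Finset.mem_union,
        Multiset.mem_toFinset, Multiset.mem_map]
      exact ⟨by rintro (h | ⟨b, -, rfl⟩); exacts [h, b.2], Or.inl⟩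
    · intro t u _ _ htu
      exact Subtype.ext (Multiset.map_injective Subtype.val_injective (add_left_cancel htu))
    · rintro M ⟨rfl, rfl⟩
      have hle : M.toFinset.val ≤ M := by
        simpa using M.dedup_le
      have hmem : ∀ a ∈ M - M.toFinset.val, a ∈ M.toFinset := fun a ha =>
        Multiset.mem_toFinset.mpr (Multiset.mem_of_le (Multiset.sub_le_self _ _) ha)
      refine ⟨⟨(M - M.toFinset.val).attach.map fun a => ⟨a.1, hmem a.1 a.2⟩, ?_⟩, trivial, ?_⟩
      · rw [Multiset.card_map, Multiset.card_attach, Multiset.card_sub hle, Finset.card_val]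
      · simp only [Multiset.map_map, Function.comp_def, Multiset.attach_map_val]
        exact add_tsub_cancel_of_le hle

theorem Finset.ncard_multiset_toFinset_card_eq {α : Type*} [DecidableEq α] (R : Finset α)
    {n s : ℕ} (hn : 0 < n) (hs : 0 < s) :
    {M : Multiset α | M.card = n ∧ M.toFinset ⊆ R ∧ M.toFinset.card = s}.ncard =
      (n - 1).choose (s - 1) * R.card.choose s := by
  let F := ((R.sym n).image Sym.toMultiset).filter fun M => M.toFinset.card = s
  have hF (M : Multiset α) : M ∈ F ↔ M.card = n ∧ M.toFinset ⊆ R ∧ M.toFinset.card = s := by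
    simp only [F, mem_filter, mem_image, mem_sym_iff]
    constructor
    · rintro ⟨⟨t, ht, rfl⟩, h⟩
      exact ⟨t.2, fun a ha => ht a (Multiset.mem_toFinset.mp ha), h⟩
    · rintro ⟨h1, h2, h3⟩
      exact ⟨⟨⟨M, h1⟩, fun a ha => h2 (Multiset.mem_toFinset.mpr ha), rfl⟩, h3⟩
  simp_rw [← hF]
  rw [setOfPred_mem, Set.ncard_coe_finset, card_eq_sum_card_fiberwise (f := Multiset.toFinset)
    (t := R.powersetCard s) fun M hM => mem_powersetCard.mpr ((hF M).mp hM).2,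
    sum_const_nat (m := (n - 1).choose (s - 1)), card_powersetCard, mul_comm]
  intro A hA
  obtain ⟨hAR, hAs⟩ := mem_powersetCard.mp hA
  rw [← hAs, ← ncard_multiset_toFinset_eq (card_pos.mp (by omega)) hn, ← Set.ncard_coe_finset]
  congr 1
  ext M
  simp only [coe_filter, hF, Set.mem_ofPred_eq]
  constructor
  · rintro ⟨⟨h, -⟩, rfl⟩
    exact ⟨h, rfl⟩
  · rintro ⟨h, rfl⟩
    exact ⟨⟨h, hAR, hAs⟩, rfl⟩

theorem toFinset_charpoly_roots {ι K : Type*} [Fintype ι] [DecidableEq ι] [Field K]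
    [DecidableEq K] (A : Matrix ι ι K) : (A.charpoly.roots.toFinset : Set K) = spectrum K A := by
  ext z
  simp [mem_spectrum_iff_isRoot_charpoly, A.charpoly_monic.ne_zero]

/-- For any positive integers `n`, `m`, `s`, the number of conjugacy classes of `U(n)`
consisting of elements `x` with `x ^ m = 1` and exactly `s` distinct eigenvalues equals
`C(n - 1, s - 1) · C(m, s)`. -/
theorem stmt_2 (n m s : ℕ) (hn : 0 < n) (hm : 0 < m) (hs : 0 < s) :
    {c : ConjClasses (Matrix.unitaryGroup (Fin n) ℂ) | ∀ x ∈ c.carrier,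
        x ^ m = 1 ∧ (spectrum ℂ (x : Matrix (Fin n) (Fin n) ℂ)).ncard = s}.ncard
      = Nat.choose (n - 1) (s - 1) * Nat.choose m s := by
  classical
  set R := Polynomial.nthRootsFinset m (1 : ℂ)
  have hR : R.card = m := (Complex.isPrimitiveRoot_exp m hm.ne').card_nthRootsFinset
  rw [← hR, ← Finset.ncard_multiset_toFinset_card_eq R hn hs, hR]
  have hconj {x y : unitaryGroup (Fin n) ℂ} (h : IsConj x y) :
      (x : Matrix (Fin n) (Fin n) ℂ).charpoly.roots =
        (y : Matrix (Fin n) (Fin n) ℂ).charpoly.roots := by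
    obtain ⟨U, rfl⟩ := isConj_iff.mp h
    change _ = (U.1 * x.1 * star U.1).charpoly.roots
    rw [charpoly_mul_comm, ← mul_assoc, mem_unitaryGroup_iff'.mp U.2, one_mul]
  let f : ConjClasses (unitaryGroup (Fin n) ℂ) → Multiset ℂ :=
    Quotient.lift (fun x => x.1.charpoly.roots) fun _ _ => hconj
  have hcard (x : unitaryGroup (Fin n) ℂ) :
      (spectrum ℂ (x : Matrix (Fin n) (Fin n) ℂ)).ncard =
        x.1.charpoly.roots.toFinset.card := by
    rw [← toFinset_charpoly_roots, Set.ncard_coe_finset]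
  refine Set.ncard_congr (fun c _ => f c) ?_ ?_ ?_
  · intro c hc
    induction c using Quotient.inductionOn with | _ x
    obtain ⟨hx, hxs⟩ := hc x ConjClasses.mem_carrier_mk
    obtain ⟨U, d, hU⟩ := exists_diagonal_of_pow_eq_one hm x hx
    refine ⟨?_, ?_, (hcard x).symm.trans hxs⟩
    · change Multiset.card x.1.charpoly.roots = n
      simp [charpoly_roots_of_mul_eq hU]
    · intro z hz
      have hz' : z ∈ spectrum ℂ x.1 := by
        rw [← toFinset_charpoly_roots]; exact hz
      rw [Polynomial.mem_nthRootsFinset hm]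
      have hp := spectrum.pow_mem_pow x.1 m hz'
      rw [show x.1 ^ m = 1 from congrArg Subtype.val hx] at hp
      have : Nonempty (Fin n) := ⟨⟨0, hn⟩⟩
      simpa using hp
  · intro c c' hc hc' h
    induction c using Quotient.inductionOn with | _ x
    induction c' using Quotient.inductionOn with | _ y
    exact ConjClasses.mk_eq_mk_iff_isConj.mpr (isConj_of_charpoly_roots_eq hm
      (hc x ConjClasses.mem_carrier_mk).1 (hc' y ConjClasses.mem_carrier_mk).1 h)
  · rintro M ⟨hMn, hMR, hMs⟩
    obtain ⟨d, rfl⟩ : ∃ d : Fin n → ℂ, Finset.univ.val.map d = M := by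
      subst hMn
      obtain ⟨l, rfl⟩ := Quot.exists_rep M
      exact ⟨l.get, (Fin.univ_val_map _).trans (congrArg _ (List.ofFn_get l))⟩
    have hd (i : Fin n) : d i ^ m = 1 :=
      (Polynomial.mem_nthRootsFinset hm _).mp (hMR (by simp))
    have hdm : diagonal d ^ m = 1 := by
      rw [diagonal_pow, ← diagonal_one]
      exact congrArg diagonal (funext hd)
    have hU : diagonal d ∈ unitaryGroup (Fin n) ℂ := by
      rw [mem_unitaryGroup_iff, star_eq_conjTranspose, diagonal_conjTranspose, diagonal_mul_diagonal,
        ← diagonal_one]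
      congr 1
      ext i
      simp [Complex.mul_conj, Complex.normSq_eq_norm_sq,
        Complex.norm_eq_one_of_pow_eq_one (hd i) hm.ne']
    have hroots : (diagonal d).charpoly.roots = Finset.univ.val.map d :=
      charpoly_roots_of_mul_eq (U := 1) (by simp)
    refine ⟨ConjClasses.mk ⟨_, hU⟩, ?_, hroots⟩
    intro y hy
    have hy' : IsConj ⟨_, hU⟩ y :=
      (ConjClasses.mk_eq_mk_iff_isConj.mp (ConjClasses.mem_carrier_iff_mk_eq.mp hy)).symm
    constructor
    · obtain ⟨V, rfl⟩ := isConj_iff.mp hy'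
      rw [conj_pow, show (⟨_, hU⟩ : unitaryGroup (Fin n) ℂ) ^ m = 1 from Subtype.ext hdm]
      group
    · rw [hcard, ← hconj hy']
      exact (congrArg (fun M => M.toFinset.card) hroots).trans hMs
end

section
/- For any positive integers n, m, and s, the number N(SU(n),m,s) of conjugacy classes of SU(n) consisting of elements x with x^m = 1 and exactly s distinct eigenvalues satisfies m · N(SU(n),m,s) = Σ_{d | gcd(n,m)} Σ_{j=0}^{n/d} φ(d) · (-1)^{j+s} · C(n/d + m/d - j - 1, n/d - j) · C(m/d, j) · C(j·d, s), where the sum is over positive divisors d of gcd(n,m) and φ is Euler's totient function (the identity is an equality of integers). -/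
open Matrix

/-- `NSUs p m s` is the number of conjugacy classes of `SU(p)` all of whose elements `x`
satisfy `x ^ m = 1` and have exactly `s` distinct eigenvalues (the cardinality of the
spectrum of the underlying complex matrix). -/
noncomputable def NSUs (p m s : ℕ) : ℕ :=
  {c : ConjClasses (SU p) | ∀ x ∈ c.carrier, x ^ m = 1 ∧
      (spectrum ℂ ((x : Matrix.unitaryGroup (Fin p) ℂ) : Matrix (Fin p) (Fin p) ℂ)).ncard = s}.ncard

section GeneratingFunction

open Polynomial Finset

/-- The power series `1 + Y (z X + z² X² + ⋯)` over `ℂ[Y]`: the choice of a multiplicity for the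
eigenvalue `z`, where `Y` marks whether `z` occurs. -/
noncomputable def multiplicitySeries (z : ℂ) : PowerSeries ℂ[X] :=
  PowerSeries.mk fun k => if k = 0 then 1 else X * C (z ^ k)

theorem multiplicitySeries_mul (z : ℂ) :
    multiplicitySeries z * (1 - PowerSeries.C (C z) * PowerSeries.X) =
      1 - PowerSeries.C (C z) * (PowerSeries.C (1 - X) * PowerSeries.X) := by
  ext1 k
  rw [mul_sub, mul_one, ← mul_assoc, ← mul_assoc, ← map_mul]
  rcases k with _ | k
  · simp [multiplicitySeries]
  · rcases k with _ | k
    · simp [multiplicitySeries, PowerSeries.coeff_succ_mul_X, PowerSeries.coeff_one]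
      ring
    · simp [multiplicitySeries, PowerSeries.coeff_succ_mul_X, PowerSeries.coeff_one]
      ring

theorem prod_nthRootsFinset_eq_prod_range {R M : Type*} [CommRing R] [IsDomain R]
    [CommMonoid M] {ω : R} {m : ℕ} (hω : IsPrimitiveRoot ω m) (g : R → M) :
    ∏ z ∈ nthRootsFinset m (1 : R), g z = ∏ i ∈ range m, g (ω ^ i) := by
  classical
  have h := hω.nthRoots_eq (α := 1) (a := 1) (one_pow m)
  simp only [mul_one] at h
  rw [Finset.prod, Finset.prod, nthRootsFinset]
  simp only [Multiset.toFinset_val]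
  rw [hω.nthRoots_one_nodup.dedup, h, Multiset.map_map]
  rfl

theorem prod_range_mul_pow {R M : Type*} [Monoid R] [CommMonoid M] {η : R} {d : ℕ}
    (hη : η ^ d = 1) (g : R → M) (k : ℕ) :
    ∏ i ∈ range (d * k), g (η ^ i) = (∏ i ∈ range d, g (η ^ i)) ^ k := by
  induction k with
  | zero => simp
  | succ k ih =>
    rw [mul_add, mul_one, prod_range_add, ih, pow_succ]
    simp [pow_add, pow_mul, hη]

theorem prod_nthRootsFinset_one_sub {ω : ℂ} {m : ℕ} (hm : 0 < m) (hω : IsPrimitiveRoot ω m)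
    (a : ℕ) (T : PowerSeries ℂ[X]) :
    ∏ z ∈ nthRootsFinset m (1 : ℂ), (1 - PowerSeries.C (C (z ^ a)) * T) =
      (1 - T ^ (m / m.gcd a)) ^ m.gcd a := by
  have hη : IsPrimitiveRoot (ω ^ a) (m / m.gcd a) := by
    rw [IsPrimitiveRoot.iff_orderOf, (hω.isOfFinOrder hm.ne').orderOf_pow, hω.eq_orderOf]
  have hd : 0 < m / m.gcd a := Nat.div_gcd_pos_of_pos_left a hm
  rw [prod_nthRootsFinset_eq_prod_range hω]
  simp_rw [← pow_mul, mul_comm _ a, pow_mul]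
  have := prod_range_mul_pow hη.pow_eq_one
    (fun z => 1 - PowerSeries.C (C z) * T) (m.gcd a)
  rw [Nat.div_mul_cancel (Nat.gcd_dvd_left m a)] at this
  rw [this]
  have hinj : Function.Injective ((PowerSeries.C (R := ℂ[X])).comp (C : ℂ →+* ℂ[X])) :=
    PowerSeries.C_injective.comp C_injective
  have h2 := (hη.map_of_injective hinj).pow_sub_pow_eq_prod_sub_mul (1 : PowerSeries ℂ[X]) T hd
  rw [one_pow, prod_nthRootsFinset_eq_prod_range (hη.map_of_injective hinj)] at h2
  rw [h2]
  simp

theorem prod_multiplicitySeries {ω : ℂ} {m : ℕ} (hm : 0 < m) (hω : IsPrimitiveRoot ω m)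
    (a : ℕ) :
    ∏ z ∈ nthRootsFinset m (1 : ℂ), multiplicitySeries (z ^ a) =
      PowerSeries.expand (m / m.gcd a) (Nat.div_gcd_pos_of_pos_left a hm).ne'
        ((1 - PowerSeries.C ((1 - X) ^ (m / m.gcd a)) * PowerSeries.X) ^ m.gcd a *
          (PowerSeries.invOneSubPow ℂ[X] (m.gcd a)).val) := by
  have h : (∏ z ∈ nthRootsFinset m (1 : ℂ), multiplicitySeries (z ^ a)) *
      (1 - PowerSeries.X ^ (m / m.gcd a)) ^ m.gcd a =
      (1 - (PowerSeries.C (1 - X) * PowerSeries.X) ^ (m / m.gcd a)) ^ m.gcd a := by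
    rw [← prod_nthRootsFinset_one_sub hm hω, ← prod_nthRootsFinset_one_sub hm hω,
      ← prod_mul_distrib]
    exact prod_congr rfl fun z _ => multiplicitySeries_mul _
  set d := m / m.gcd a
  have hd : d ≠ 0 := (Nat.div_gcd_pos_of_pos_left a hm).ne'
  have h1 : (1 - PowerSeries.X ^ d : PowerSeries ℂ[X]) ^ m.gcd a *
      PowerSeries.expand d hd (PowerSeries.invOneSubPow ℂ[X] (m.gcd a)).val = 1 := by
    have := (PowerSeries.invOneSubPow ℂ[X] (m.gcd a)).inv_val
    rw [PowerSeries.invOneSubPow_inv_eq_one_sub_pow] at this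
    have := congrArg (PowerSeries.expand d hd) this
    simpa using this
  rw [map_mul, map_pow, map_sub, map_mul, map_one, PowerSeries.expand_C, PowerSeries.expand_X,
    map_pow, ← mul_pow, ← h, mul_assoc, h1, mul_one]

theorem coeff_one_sub_C_mul_X_pow {R : Type*} [CommRing R] (c : R) (e j : ℕ) :
    PowerSeries.coeff j ((1 - PowerSeries.C c * PowerSeries.X) ^ e) =
      (-c) ^ j * (e.choose j : R) := by
  have h : (1 - PowerSeries.C c * PowerSeries.X : PowerSeries R) ^ e =
      (((1 + X) ^ e : R[X]).comp (C (-c) * X) : R[X]) := by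
    simp [sub_eq_add_neg]
  rw [h, Polynomial.coeff_coe, comp_C_mul_X_coeff, coeff_one_add_X_pow, mul_comm]

theorem coeff_one_sub_X_pow (k s : ℕ) :
    ((1 - X : ℂ[X]) ^ k).coeff s = (-1) ^ s * (k.choose s : ℂ) := by
  have := coeff_one_sub_C_mul_X_pow (1 : ℂ) k s
  rw [← this, ← Polynomial.coeff_coe]
  simp

theorem coeff_prod_multiplicitySeries {ω : ℂ} {m : ℕ} (hm : 0 < m) (hω : IsPrimitiveRoot ω m)
    (a n s : ℕ) :
    (PowerSeries.coeff n (∏ z ∈ nthRootsFinset m (1 : ℂ), multiplicitySeries (z ^ a))).coeff s =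
      if m / m.gcd a ∣ n then
        ∑ j ∈ range (n / (m / m.gcd a) + 1), (-1) ^ (j + s) *
          (Nat.choose (n / (m / m.gcd a) + m.gcd a - j - 1) (n / (m / m.gcd a) - j) : ℂ) *
            (Nat.choose (m.gcd a) j : ℂ) * (Nat.choose (j * (m / m.gcd a)) s : ℂ)
      else 0 := by
  have he : 0 < m.gcd a := Nat.gcd_pos_of_pos_left a hm
  rw [prod_multiplicitySeries hm hω, PowerSeries.coeff_expand]
  split_ifs with hdvd
  · rw [PowerSeries.coeff_mul, Finset.Nat.sum_antidiagonal_eq_sum_range_succ_mk, finsetSum_coeff]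
    refine sum_congr rfl fun j hj => ?_
    have hj : j ≤ n / (m / m.gcd a) := Nat.lt_succ_iff.1 (mem_range.1 hj)
    generalize n / (m / m.gcd a) = q at *
    generalize m / m.gcd a = d at *
    generalize m.gcd a = e at *
    rw [coeff_one_sub_C_mul_X_pow, PowerSeries.invOneSubPow_val_eq_mk_sub_one_add_choose_of_pos
      _ _ he, PowerSeries.coeff_mk]
    have h1 : (e - 1 + (q - j)).choose (e - 1) = (q + e - j - 1).choose (q - j) := by
      rw [show q + e - j - 1 = e - 1 + (q - j) by omega, Nat.choose_symm_add]
    rw [h1, neg_pow, ← pow_mul, mul_assoc, ← Nat.cast_mul,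
      show ((-1 : ℂ[X]) ^ j) = C ((-1) ^ j) by simp, mul_assoc, coeff_C_mul,
      ← C_eq_natCast, coeff_mul_C, coeff_one_sub_X_pow, mul_comm d j]
    push_cast
    ring
  · simp

theorem sum_range_pow_eq_ite {m : ℕ} (p : ℂ) (hp : p ^ m = 1) :
    ∑ a ∈ range m, p ^ a = if p = 1 then (m : ℂ) else 0 := by
  split_ifs with h
  · simp [h]
  · rw [geom_sum_eq h, hp]; simp

theorem coeff_coeff_prod_multiplicitySeries_eq_sum (S : Finset ℂ) (a n s : ℕ) :
    (PowerSeries.coeff n (∏ z ∈ S, multiplicitySeries (z ^ a))).coeff s =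
      ∑ l ∈ finsuppAntidiag S n, if #l.support = s then (∏ z ∈ S, z ^ l z) ^ a else 0 := by
  rw [PowerSeries.coeff_prod, finsetSum_coeff]
  refine sum_congr rfl fun l hl => ?_
  have hsupp : l.support ⊆ S := (mem_finsuppAntidiag.1 hl).2
  have : ∏ z ∈ S, PowerSeries.coeff (l z) (multiplicitySeries (z ^ a)) =
      C ((∏ z ∈ S, z ^ l z) ^ a) * X ^ #l.support := by
    have h (z : ℂ) : PowerSeries.coeff (l z) (multiplicitySeries (z ^ a)) =
        (if z ∈ l.support then X else 1) * C ((z ^ l z) ^ a) := by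
      by_cases hz : l z = 0
      · simp [multiplicitySeries, hz]
      · simp [multiplicitySeries, hz, ← pow_mul, mul_comm]
    simp_rw [h]
    rw [prod_mul_distrib, prod_ite_mem, inter_eq_right.2 hsupp, prod_const, ← map_prod, prod_pow,
      mul_comm]
  rw [this, coeff_C_mul_X_pow]
  simp [eq_comm]

theorem card_finsuppAntidiag_nthRootsFinset (n m s : ℕ) (hn : 0 < n) (hm : 0 < m) :
    (m : ℤ) * (#{l ∈ finsuppAntidiag (nthRootsFinset m (1 : ℂ)) n |
        ∏ z ∈ nthRootsFinset m (1 : ℂ), z ^ l z = 1 ∧ #l.support = s} : ℤ)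
      = ∑ d ∈ (Nat.gcd n m).divisors, ∑ j ∈ Finset.range (n / d + 1),
          (Nat.totient d : ℤ) * (-1) ^ (j + s) *
            (Nat.choose (n / d + m / d - j - 1) (n / d - j) : ℤ) *
            (Nat.choose (m / d) j : ℤ) * (Nat.choose (j * d) s : ℤ) := by
  apply Int.cast_injective (α := ℂ)
  push_cast
  have hω := Complex.isPrimitiveRoot_exp m hm.ne'
  set ω := Complex.exp (2 * Real.pi * Complex.I / m)
  set S := nthRootsFinset m (1 : ℂ)
  let G (d : ℕ) : ℂ := ∑ j ∈ range (n / d + 1), (-1) ^ (j + s) *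
    (Nat.choose (n / d + m / d - j - 1) (n / d - j) : ℂ) *
    (Nat.choose (m / d) j : ℂ) * (Nat.choose (j * d) s : ℂ)
  have hG (a : ℕ) :
      (PowerSeries.coeff n (∏ z ∈ S, multiplicitySeries (z ^ a))).coeff s =
        if m / m.gcd a ∣ n then G (m / m.gcd a) else 0 := by
    rw [coeff_prod_multiplicitySeries hm hω]
    simp only [G, Nat.div_div_self (Nat.gcd_dvd_left m a) hm.ne']
  calc _ = ∑ l ∈ finsuppAntidiag S n,
        if #l.support = s then (if ∏ z ∈ S, z ^ l z = 1 then (m : ℂ) else 0) else 0 := by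
        rw [card_filter]
        push_cast
        rw [mul_sum]
        refine sum_congr rfl fun l _ => ?_
        split_ifs <;> simp_all
    _ = ∑ a ∈ range m, (PowerSeries.coeff n (∏ z ∈ S, multiplicitySeries (z ^ a))).coeff s := by
        simp_rw [coeff_coeff_prod_multiplicitySeries_eq_sum]
        rw [sum_comm]
        refine sum_congr rfl fun l _ => ?_
        split_ifs with h1 h2
        · simp [h2]
        · rw [sum_range_pow_eq_ite _ ?_, if_neg h2]
          rw [← prod_pow]
          refine prod_eq_one fun z hz => ?_
          rw [← pow_mul, mul_comm, pow_mul, (mem_nthRootsFinset hm 1).1 hz, one_pow]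
        · simp
    _ = ∑ d ∈ m.divisors, ∑ a ∈ range m with m.gcd a = m / d, if d ∣ n then G d else 0 := by
        simp_rw [hG]
        rw [← sum_fiberwise_of_maps_to (g := fun a => m / m.gcd a) (t := m.divisors)]
        · refine sum_congr rfl fun d hd => ?_
          have hd := Nat.dvd_of_mem_divisors hd
          have key (a : ℕ) : m / m.gcd a = d ↔ m.gcd a = m / d := by
            constructor
            · rintro rfl
              rw [Nat.div_div_self (Nat.gcd_dvd_left m a) hm.ne']
            · intro h
              rw [h, Nat.div_div_self hd hm.ne']
          simp_rw [← key]
          refine sum_congr rfl fun a ha => ?_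
          rw [(mem_filter.1 ha).2]
        · intro a _
          exact Nat.mem_divisors.2 ⟨Nat.div_dvd_of_dvd (Nat.gcd_dvd_left m a), hm.ne'⟩
    _ = ∑ d ∈ m.divisors, if d ∣ n then (d.totient : ℂ) * G d else 0 := by
        refine sum_congr rfl fun d hd => ?_
        have hd := Nat.dvd_of_mem_divisors hd
        rw [sum_const, ← Nat.totient_div_of_dvd (Nat.div_dvd_of_dvd hd),
          Nat.div_div_self hd hm.ne']
        simp
    _ = _ := by
        rw [← sum_filter]
        refine sum_congr ?_ fun d _ => ?_
        · ext d
          simp [Nat.dvd_gcd_iff, hm.ne', hn.ne', and_comm]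
        · simp only [G, mul_sum, mul_assoc]

end GeneratingFunction

section Conjugacy

open Module.End Polynomial

variable {n m : ℕ}

theorem isOrtho_eigenspace_of_unitary (x : unitaryGroup (Fin n) ℂ) {a b : ℂ} (hab : a ≠ b) :
    eigenspace (toEuclideanLin (x : Matrix (Fin n) (Fin n) ℂ)) a ⟂
      eigenspace (toEuclideanLin (x : Matrix (Fin n) (Fin n) ℂ)) b := by
  set T := toEuclideanLin (x : Matrix (Fin n) (Fin n) ℂ) with hT
  have hinner (u v : EuclideanSpace ℂ (Fin n)) : inner ℂ (T u) (T v) = inner ℂ u v := by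
    rw [← LinearMap.adjoint_inner_right, hT, ← toEuclideanLin_conjTranspose_eq_adjoint]
    rw [← LinearMap.comp_apply, ← toLpLin_mul_same,
      ← star_eq_conjTranspose, mem_unitaryGroup_iff'.1 x.2, toLpLin_one, LinearMap.id_apply]
  rw [Submodule.isOrtho_iff_inner_eq]
  intro u hu v hv
  rw [mem_eigenspace_iff] at hu hv
  by_contra h
  have h1 := hinner u v
  have h2 := hinner u u
  have hu0 : inner ℂ u u ≠ 0 := by
    rw [inner_self_ne_zero]
    rintro rfl
    simp at h
  rw [hu, hv, inner_smul_left, inner_smul_right, ← mul_assoc, mul_eq_right₀ h] at h1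
  rw [hu, inner_smul_left, inner_smul_right, ← mul_assoc, mul_eq_right₀ hu0] at h2
  refine hab (mul_left_cancel₀ (left_ne_zero_of_mul_eq_one h1) (h2.trans h1.symm))

theorem iSup_eigenspace_eq_top_of_pow_eq_one {V : Type*} [AddCommGroup V] [Module ℂ V]
    [FiniteDimensional ℂ V] (hm : 0 < m) (T : Module.End ℂ V) (hT : T ^ m = 1) :
    ⨆ a : T.Eigenvalues, eigenspace T a = ⊤ := by
  have hss : T.IsSemisimple := by
    refine isSemisimple_of_squarefree_aeval_eq_zero (p := X ^ m - 1) ?_ (by simp [hT])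
    exact (X_pow_sub_one_separable_iff.2 (by exact_mod_cast hm.ne')).squarefree
  rw [← iSup_maxGenEigenspace_eq_top T]
  simp_rw [hss.isFinitelySemisimple.maxGenEigenspace_eq_eigenspace]
  exact iSup_ne_bot_subtype (fun a => eigenspace T a)

/-- A unitary matrix of finite order is diagonalizable in an orthonormal basis. -/
theorem exists_mul_eq_mul_diagonal (hm : 0 < m) (x : unitaryGroup (Fin n) ℂ) (hx : x ^ m = 1) :
    ∃ (g : unitaryGroup (Fin n) ℂ) (d : Fin n → ℂ),
      (x : Matrix (Fin n) (Fin n) ℂ) * g = g * diagonal d := by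
  set T := toEuclideanLin (x : Matrix (Fin n) (Fin n) ℂ) with hT
  have hTm : T ^ m = 1 := by
    have := congrArg (fun y : unitaryGroup (Fin n) ℂ => (y : Matrix (Fin n) (Fin n) ℂ)) hx
    rw [hT, ← toLpLin_pow, ← SubmonoidClass.coe_pow, hx]
    exact toLpLin_one _
  have hV : OrthogonalFamily ℂ (fun a : Eigenvalues T => eigenspace T a)
      fun a => (eigenspace T a).subtypeₗᵢ :=
    OrthogonalFamily.of_pairwise fun a b hab =>
      isOrtho_eigenspace_of_unitary x (Subtype.coe_injective.ne hab)
  have hint : DirectSum.IsInternal fun a : Eigenvalues T => eigenspace T a := by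
    rw [hV.isInternal_iff, iSup_eigenspace_eq_top_of_pow_eq_one hm T hTm,
      Submodule.top_orthogonal_eq_bot]
  have hfr : Module.finrank ℂ (EuclideanSpace ℂ (Fin n)) = n := by simp
  let b := hint.subordinateOrthonormalBasis hfr hV
  refine ⟨⟨(EuclideanSpace.basisFun (Fin n) ℂ).toBasis.toMatrix b,
    (EuclideanSpace.basisFun (Fin n) ℂ).toMatrix_orthonormalBasis_mem_unitary b⟩,
    fun j => (hint.subordinateOrthonormalBasisIndex hfr j hV : Eigenvalues T), ?_⟩
  ext i j
  have h := hint.subordinateOrthonormalBasis_subordinate hfr j hV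
  rw [mem_eigenspace_iff] at h
  have h := congrArg (fun v : EuclideanSpace ℂ (Fin n) => v i) h
  rw [mul_diagonal]
  simpa [T, toLpLin_apply, mulVec, dotProduct, Matrix.mul_apply,
    Module.Basis.toMatrix_apply, b, mul_comm] using h

theorem charpoly_eq_of_mul_eq_mul {x y : Matrix (Fin n) (Fin n) ℂ} (g : unitaryGroup (Fin n) ℂ)
    (h : x * g = g * y) : x.charpoly = y.charpoly := by
  have hx : x = (Unitary.toUnits g : (Matrix (Fin n) (Fin n) ℂ)ˣ) * y *
      ((Unitary.toUnits g)⁻¹ : (Matrix (Fin n) (Fin n) ℂ)ˣ) := by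
    rw [Units.eq_mul_inv_iff_mul_eq]
    exact h
  rw [hx, coe_units_inv, charpoly_units_conj]

theorem roots_charpoly_diagonal (d : Fin n → ℂ) :
    (diagonal d).charpoly.roots = Finset.univ.val.map d := by
  rw [charpoly_diagonal, roots_prod _ _ (Finset.prod_ne_zero_iff.2 fun i _ => X_sub_C_ne_zero _)]
  simp [Multiset.bind_singleton]

theorem exists_perm_comp_eq {ι α : Type*} [Fintype ι] {d e : ι → α}
    (h : Finset.univ.val.map d = Finset.univ.val.map e) : ∃ σ : Equiv.Perm ι, e ∘ σ = d := by
  classical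
  have hcard (a : α) : Fintype.card {i // d i = a} = Fintype.card {i // e i = a} := by
    have := congrArg (Multiset.count a) h
    rw [Multiset.count_map, Multiset.count_map] at this
    simpa [Fintype.card_subtype, eq_comm, Finset.card_def] using this
  exact ⟨Equiv.ofFiberEquiv fun a => Fintype.equivOfCardEq (hcard a),
    funext fun i => Equiv.ofFiberEquiv_map _ i⟩

theorem isConj_of_charpoly_eq (hm : 0 < m) (x y : unitaryGroup (Fin n) ℂ) (hx : x ^ m = 1)
    (hy : y ^ m = 1) (h : (x : Matrix (Fin n) (Fin n) ℂ).charpoly = charpoly y.1) :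
    IsConj x y := by
  obtain ⟨g, d, hg⟩ := exists_mul_eq_mul_diagonal hm x hx
  obtain ⟨k, e, hk⟩ := exists_mul_eq_mul_diagonal hm y hy
  rw [charpoly_eq_of_mul_eq_mul g hg, charpoly_eq_of_mul_eq_mul k hk] at h
  obtain ⟨σ, rfl⟩ := exists_perm_comp_eq (d := d) (e := e)
    (by rw [← roots_charpoly_diagonal, h, roots_charpoly_diagonal])
  let k' : unitaryGroup (Fin n) ℂ := ⟨k.1.submatrix id σ, by
    rw [mem_unitaryGroup_iff', star_eq_conjTranspose, conjTranspose_submatrix,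
      ← submatrix_mul _ _ _ id _ Function.bijective_id, ← star_eq_conjTranspose,
      mem_unitaryGroup_iff'.1 k.2, submatrix_one_equiv]⟩
  have hk' : (y : Matrix (Fin n) (Fin n) ℂ) * k' = k' * diagonal (e ∘ σ) := by
    ext i j
    have := congrFun (congrFun hk i) (σ j)
    rw [mul_diagonal] at this ⊢
    exact this
  refine isConj_iff.2 ⟨k' * g⁻¹, ?_⟩
  rw [mul_inv_eq_iff_eq_mul]
  have hyx : y * k' * g⁻¹ = k' * (g⁻¹ * (x * g)) * g⁻¹ := by
    congr 1
    apply Subtype.ext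
    change y.1 * k'.1 = k'.1 * (star g.1 * (x.1 * g.1))
    rw [hg, ← mul_assoc (star g.1), mem_unitaryGroup_iff'.1 g.2, one_mul, hk']
  rw [← mul_assoc, hyx]
  group

theorem SU.isConj_of_isConj_coe (hn : 0 < n) (x y : SU n)
    (h : IsConj (x : unitaryGroup (Fin n) ℂ) y) : IsConj x y := by
  obtain ⟨c, hc⟩ := isConj_iff.1 h
  obtain ⟨w, hw⟩ := IsAlgClosed.exists_pow_nat_eq (det c.1)⁻¹ hn
  have hδ : ‖det c.1‖ = 1 := by
    exact CStarRing.norm_of_mem_unitary (det_of_mem_unitary c.2)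
  have hw1 : ‖w‖ = 1 := by
    rw [← pow_eq_one_iff_of_nonneg (norm_nonneg w) hn.ne', ← norm_pow, hw, norm_inv, hδ, inv_one]
  have hw' : star w * w = 1 := by
    have := Complex.conj_mul' w
    simpa [hw1] using this
  let c' : SU n := ⟨⟨w • c.1, by
    rw [mem_unitaryGroup_iff', star_smul, smul_mul_smul_comm, hw', mem_unitaryGroup_iff'.1 c.2,
      one_smul]⟩, by
    change det (w • c.1) = 1
    rw [det_smul, Fintype.card_fin, hw, inv_mul_cancel₀]
    intro h0
    simp [h0] at hδ⟩
  refine isConj_iff.2 ⟨c', ?_⟩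
  rw [mul_inv_eq_iff_eq_mul] at hc ⊢
  have hc := congrArg (fun z : unitaryGroup (Fin n) ℂ => w • z.1) hc
  apply Subtype.ext
  apply Subtype.ext
  change (w • c.1) * x.1.1 = y.1.1 * (w • c.1)
  rw [smul_mul_assoc, mul_smul_comm]
  exact hc

theorem pow_eq_one_iff_roots_charpoly (g x : unitaryGroup (Fin n) ℂ) (d : Fin n → ℂ)
    (h : (x : Matrix (Fin n) (Fin n) ℂ) * g = g * diagonal d) :
    x ^ m = 1 ↔ ∀ z ∈ (x : Matrix (Fin n) (Fin n) ℂ).charpoly.roots, z ^ m = 1 := by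
  have hpow : (x : Matrix (Fin n) (Fin n) ℂ) ^ m * g = g * diagonal (d ^ m) := by
    rw [← diagonal_pow]
    exact (show SemiconjBy _ _ _ from h.symm).pow_right m |>.symm
  rw [charpoly_eq_of_mul_eq_mul g h, roots_charpoly_diagonal]
  simp only [Multiset.mem_map, Finset.mem_val, Finset.mem_univ, true_and, forall_exists_index,
    forall_apply_eq_imp_iff]
  constructor
  · intro hx
    rw [← SubmonoidClass.coe_pow, hx, OneMemClass.coe_one, one_mul] at hpow
    have := congrArg (star g.1 * ·) hpow
    simp only [← mul_assoc, mem_unitaryGroup_iff'.1 g.2, one_mul] at this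
    intro i
    have := congrFun (congrFun this i) i
    simpa using this.symm
  · intro hd
    have hd1 : d ^ m = 1 := funext hd
    rw [hd1, diagonal_one', mul_one] at hpow
    apply Subtype.ext
    rw [SubmonoidClass.coe_pow, OneMemClass.coe_one]
    have := congrArg (· * star g.1) hpow
    simpa only [mul_assoc, mem_unitaryGroup_iff.1 g.2, mul_one] using this

theorem ncard_spectrum_eq (x : Matrix (Fin n) (Fin n) ℂ) :
    (spectrum ℂ x).ncard = x.charpoly.roots.toFinset.card := by
  rw [← Set.ncard_coe_finset]
  congr 1
  ext z
  rw [Matrix.mem_spectrum_iff_isRoot_charpoly]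
  simp [x.charpoly_monic.ne_zero]

theorem toFinsupp_mem_finsuppAntidiag_iff (hm : 0 < m) (s : ℕ) (M : Multiset ℂ) :
    M.toFinsupp ∈ {l ∈ Finset.finsuppAntidiag (nthRootsFinset m (1 : ℂ)) n |
        ∏ z ∈ nthRootsFinset m (1 : ℂ), z ^ l z = 1 ∧ l.support.card = s} ↔
      M.card = n ∧ (∀ z ∈ M, z ^ m = 1) ∧ M.prod = 1 ∧ M.toFinset.card = s := by
  rw [Finset.mem_filter, Finset.mem_finsuppAntidiag, Multiset.toFinsupp_support]
  have hsub : M.toFinset ⊆ nthRootsFinset m (1 : ℂ) ↔ ∀ z ∈ M, z ^ m = 1 := by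
    simp [Finset.subset_iff, mem_nthRootsFinset hm]
  rw [hsub]
  by_cases h : ∀ z ∈ M, z ^ m = 1
  · change ((∑ z ∈ nthRootsFinset m (1 : ℂ), M.count z = n) ∧ _) ∧
      ∏ z ∈ nthRootsFinset m (1 : ℂ), z ^ M.count z = 1 ∧ _ ↔ _
    rw [Multiset.sum_count_eq_card fun z hz => (mem_nthRootsFinset hm 1).2 (h z hz),
      ← Finset.prod_multiset_count_of_subset _ _ (hsub.2 h)]
    tauto
  · tauto

/-- The multiplicity function of the eigenvalues of a conjugacy class of `SU(n)`. -/
noncomputable def eigenvalueMultiplicity (c : ConjClasses (SU n)) : ℂ →₀ ℕ :=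
  Quotient.liftOn c (fun x => Multiset.toFinsupp (charpoly x.1.1).roots) fun x y h => by
    obtain ⟨c, hc⟩ := isConj_iff.1 h.symm
    rw [mul_inv_eq_iff_eq_mul] at hc
    rw [charpoly_eq_of_mul_eq_mul (x := x.1.1) (y := y.1.1) c.1]
    exact (congrArg (fun z : SU n => z.1.1) hc).symm

theorem eigenvalueMultiplicity_mk (x : SU n) :
    eigenvalueMultiplicity (ConjClasses.mk x) = Multiset.toFinsupp (charpoly x.1.1).roots :=
  rfl

theorem card_roots_charpoly (x : Matrix (Fin n) (Fin n) ℂ) : x.charpoly.roots.card = n := by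
  rw [← (IsAlgClosed.splits x.charpoly).natDegree_eq_card_roots, charpoly_natDegree_eq_dim,
    Fintype.card_fin]

theorem NSUs_eq_card (hn : 0 < n) (hm : 0 < m) (s : ℕ) :
    NSUs n m s = Finset.card {l ∈ Finset.finsuppAntidiag (nthRootsFinset m (1 : ℂ)) n |
        ∏ z ∈ nthRootsFinset m (1 : ℂ), z ^ l z = 1 ∧ l.support.card = s} := by
  rw [NSUs, ← Set.ncard_coe_finset]
  refine Set.BijOn.ncard_eq (f := eigenvalueMultiplicity) ⟨?_, ?_, ?_⟩
  · intro c hc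
    obtain ⟨x, rfl⟩ := ConjClasses.exists_rep c
    obtain ⟨hx, hs⟩ := hc x ConjClasses.mem_carrier_mk
    have hx : x.1 ^ m = 1 := congrArg Subtype.val hx
    obtain ⟨g, d, hg⟩ := exists_mul_eq_mul_diagonal hm x.1 hx
    rw [eigenvalueMultiplicity_mk, Finset.mem_coe, toFinsupp_mem_finsuppAntidiag_iff hm]
    refine ⟨card_roots_charpoly _, (pow_eq_one_iff_roots_charpoly g x.1 d hg).1 hx, ?_, ?_⟩
    · rw [← det_eq_prod_roots_charpoly]
      exact x.2
    · rw [← ncard_spectrum_eq, hs]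
  · intro c hc c' hc' h
    obtain ⟨x, rfl⟩ := ConjClasses.exists_rep c
    obtain ⟨y, rfl⟩ := ConjClasses.exists_rep c'
    have hx : x.1 ^ m = 1 := congrArg Subtype.val (hc x ConjClasses.mem_carrier_mk).1
    have hy : y.1 ^ m = 1 := congrArg Subtype.val (hc' y ConjClasses.mem_carrier_mk).1
    rw [eigenvalueMultiplicity_mk, eigenvalueMultiplicity_mk] at h
    have hroots := Multiset.toFinsupp.injective h
    refine ConjClasses.mk_eq_mk_iff_isConj.2
      (SU.isConj_of_isConj_coe hn x y (isConj_of_charpoly_eq hm x.1 y.1 hx hy ?_))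
    rw [(IsAlgClosed.splits (charpoly x.1.1)).eq_prod_roots_of_monic (charpoly_monic _),
      (IsAlgClosed.splits (charpoly y.1.1)).eq_prod_roots_of_monic (charpoly_monic _), hroots]
  · intro l hl
    obtain ⟨M, rfl⟩ := Multiset.toFinsupp.surjective l
    rw [Finset.mem_coe, toFinsupp_mem_finsuppAntidiag_iff hm] at hl
    obtain ⟨hcard, hroot, hprod, hs⟩ := hl
    obtain ⟨d, rfl⟩ : ∃ d : Fin n → ℂ, M = Finset.univ.val.map d := by
      obtain ⟨L, rfl⟩ : ∃ L : List ℂ, (L : Multiset ℂ) = M := ⟨M.toList, M.coe_toList⟩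
      rw [Multiset.coe_card] at hcard
      subst hcard
      exact ⟨L.get, by rw [Fin.univ_val_map, List.ofFn_get]⟩
    have hd (i : Fin n) : d i ^ m = 1 := hroot _ (by simp)
    let u : unitaryGroup (Fin n) ℂ := ⟨diagonal d, by
      rw [mem_unitaryGroup_iff', star_eq_conjTranspose, diagonal_conjTranspose,
        diagonal_mul_diagonal, ← diagonal_one]
      congr 1
      ext i
      have h1 := Complex.conj_mul' (d i)
      rw [Complex.norm_eq_one_of_pow_eq_one (hd i) hm.ne'] at h1
      simpa using h1⟩
    let x : SU n := ⟨u, by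
      change det (diagonal d) = 1
      rw [det_diagonal]
      exact hprod⟩
    have hx : charpoly x.1.1 = (diagonal d).charpoly := rfl
    have hpow : u ^ m = 1 :=
      (pow_eq_one_iff_roots_charpoly 1 u d (by simp [u])).2 (by
        change ∀ z ∈ (diagonal d).charpoly.roots, _
        rwa [roots_charpoly_diagonal])
    have hxm : x ^ m = 1 := Subtype.ext hpow
    refine ⟨ConjClasses.mk x, ?_, ?_⟩
    · intro y hy
      obtain ⟨c, rfl⟩ := isConj_iff.1 (ConjClasses.mem_carrier_iff_mk_eq.1 hy |> fun h =>
        (ConjClasses.mk_eq_mk_iff_isConj.1 h).symm)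
      refine ⟨by rw [conj_pow, hxm, mul_one, mul_inv_cancel], ?_⟩
      rw [ncard_spectrum_eq, charpoly_eq_of_mul_eq_mul (y := x.1.1) c.1, hx,
        roots_charpoly_diagonal, hs]
      have : c * x * c⁻¹ * c = c * x := by group
      exact congrArg (fun z : SU n => z.1.1) this
    · rw [eigenvalueMultiplicity_mk, hx, roots_charpoly_diagonal]

end Conjugacy

/-- For any positive integers `n`, `m`, `s`,
`m · N(SU(n), m, s) = Σ_{d | gcd(n,m)} Σ_{j=0}^{n/d} φ(d) · (-1)^(j+s) ·
C(n/d + m/d - j - 1, n/d - j) · C(m/d, j) · C(jd, s)`, as an identity of integers. -/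
theorem stmt_5 (n m s : ℕ) (hn : 0 < n) (hm : 0 < m) (hs : 0 < s) :
    (m : ℤ) * (NSUs n m s : ℤ)
      = ∑ d ∈ (Nat.gcd n m).divisors, ∑ j ∈ Finset.range (n / d + 1),
          (Nat.totient d : ℤ) * (-1) ^ (j + s) *
            (Nat.choose (n / d + m / d - j - 1) (n / d - j) : ℤ) *
            (Nat.choose (m / d) j : ℤ) * (Nat.choose (j * d) s : ℤ) := by
  rw [NSUs_eq_card hn hm, card_finsuppAntidiag_nthRootsFinset n m s hn hm]
end
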